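/- arXiv:2001.05627 — 3 statements merged into one kernel-verified Lean document; each statement's English description precedes it below -/
import Mathlib

section
/- Suppose P₁, P₂ ⊆ Λ₂ are compatible plaquette sets. Then every 2-form q ∈ G^{Λ₂} with dq = 0 and supp(q) = P₁ ∪ P₂ has a unique decomposition q = q¹ + q², where q¹, q² ∈ G^{Λ₂}, dq¹ = dq² = 0, supp(q¹) = P₁, and supp(q²) = P₂. -/
open scoped BigOperators

attribute [local instance 10] Classical.propDecidable

noncomputable section

/-- Vertices of the lattice `ℤ⁴`. -/
abbrev V4 := Fin 4 → ℤ

/-- The `i`-th standard basis vector. -/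
def unitVec (i : Fin 4) : V4 := fun j => if j = i then 1 else 0

/-- A positively oriented edge, given by its base vertex and its direction. -/
abbrev Edge := V4 × Fin 4

/-- A positively oriented plaquette, given by a base vertex and two directions
(canonically the first strictly less than the second). -/
abbrev Plaq := V4 × Fin 4 × Fin 4

/-- A 3-cell, given by a base vertex and three directions (canonically sorted). -/
abbrev Cell3 := V4 × Fin 4 × Fin 4 × Fin 4

/-- Membership in the cube with corner `a` and side length `N`. -/
def inCube (a : V4) (N : ℕ) (x : V4) : Prop := ∀ i, a i ≤ x i ∧ x i ≤ a i + N

def cubeTop (a : V4) (N : ℕ) : V4 := fun i => a i + N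

def vertexFinset (a : V4) (N : ℕ) : Finset V4 := Finset.Icc a (cubeTop a N)

/-- The edge `e` has both endpoints in the cube. -/
def edgeInCube (a : V4) (N : ℕ) (e : Edge) : Prop :=
  inCube a N e.1 ∧ inCube a N (e.1 + unitVec e.2)

/-- `Λ₁`: the positively oriented edges of the cube. -/
def edgeFinset (a : V4) (N : ℕ) : Finset Edge :=
  (vertexFinset a N ×ˢ Finset.univ).filter (edgeInCube a N)

def plaqVerts (p : Plaq) : List V4 :=
  [p.1, p.1 + unitVec p.2.1, p.1 + unitVec p.2.2, p.1 + unitVec p.2.1 + unitVec p.2.2]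

/-- The plaquette `p` is canonically oriented and has all four vertices in the cube. -/
def plaqInCube (a : V4) (N : ℕ) (p : Plaq) : Prop :=
  p.2.1 < p.2.2 ∧ ∀ x ∈ plaqVerts p, inCube a N x

/-- `Λ₂`: the positively oriented plaquettes of the cube. -/
def plaqFinset (a : V4) (N : ℕ) : Finset Plaq :=
  (vertexFinset a N ×ˢ (Finset.univ ×ˢ Finset.univ)).filter (plaqInCube a N)

def cell3Sorted (c : Cell3) : Prop := c.2.1 < c.2.2.1 ∧ c.2.2.1 < c.2.2.2

def cell3Verts (c : Cell3) : List V4 :=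
  [c.1, c.1 + unitVec c.2.1, c.1 + unitVec c.2.2.1, c.1 + unitVec c.2.2.2,
   c.1 + unitVec c.2.1 + unitVec c.2.2.1, c.1 + unitVec c.2.1 + unitVec c.2.2.2,
   c.1 + unitVec c.2.2.1 + unitVec c.2.2.2,
   c.1 + unitVec c.2.1 + unitVec c.2.2.1 + unitVec c.2.2.2]

/-- The 3-cell `c` is canonically oriented and is contained in the cube. -/
def cell3InCube (a : V4) (N : ℕ) (c : Cell3) : Prop :=
  cell3Sorted c ∧ ∀ x ∈ cell3Verts c, inCube a N x

variable {G : Type} [AddCommGroup G] [Fintype G] [DecidableEq G]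

/-- An edge configuration on the cube: a `G`-valued function on `Λ₁`. -/
abbrev Conf (a : V4) (N : ℕ) (G : Type) := {e // e ∈ edgeFinset a N} → G

/-- Extension of an edge configuration by `0` to all positively oriented edges. -/
def extE (a : V4) (N : ℕ) (σ : Conf a N G) (e : Edge) : G :=
  if h : e ∈ edgeFinset a N then σ ⟨e, h⟩ else 0

/-- The discrete exterior derivative of an edge configuration, evaluated on a plaquette:
`(dσ)_p = σ_{e₁} + σ_{e₂} - σ_{e₃} - σ_{e₄}` around the boundary of `p`. -/
def dConf (a : V4) (N : ℕ) (σ : Conf a N G) (p : Plaq) : G :=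
  extE a N σ (p.1, p.2.1) + extE a N σ (p.1 + unitVec p.2.1, p.2.2)
    - extE a N σ (p.1 + unitVec p.2.2, p.2.1) - extE a N σ (p.1, p.2.2)

/-- A `G`-valued 2-form on the cube. -/
abbrev Form2 (a : V4) (N : ℕ) (G : Type) := {p // p ∈ plaqFinset a N} → G

/-- Extension of a 2-form by `0` to all positively oriented plaquettes. -/
def extP (a : V4) (N : ℕ) (q : Form2 a N G) (p : Plaq) : G :=
  if h : p ∈ plaqFinset a N then q ⟨p, h⟩ else 0

/-- The discrete exterior derivative of a 2-form, evaluated on a 3-cell. -/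
def dForm2 (a : V4) (N : ℕ) (q : Form2 a N G) (c : Cell3) : G :=
  - extP a N q (c.1, c.2.2.1, c.2.2.2) + extP a N q (c.1, c.2.1, c.2.2.2)
    - extP a N q (c.1, c.2.1, c.2.2.1)
    + extP a N q (c.1 + unitVec c.2.1, c.2.2.1, c.2.2.2)
    - extP a N q (c.1 + unitVec c.2.2.1, c.2.1, c.2.2.2)
    + extP a N q (c.1 + unitVec c.2.2.2, c.2.1, c.2.2.1)

/-- A 2-form is closed if `dq = 0` on every 3-cell of the cube. -/
def Closed2 (a : V4) (N : ℕ) (q : Form2 a N G) : Prop :=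
  ∀ c : Cell3, cell3InCube a N c → dForm2 a N q c = 0

/-- The support of a 2-form. -/
def supp2 (a : V4) (N : ℕ) (q : Form2 a N G) : Finset Plaq :=
  (plaqFinset a N).filter (fun p => extP a N q p ≠ 0)

/-- `φ_β(g) = exp(-β Re(1 - χ(g)))`. -/
def phi (β : ℝ) (χ : G → ℂ) (g : G) : ℝ := Real.exp (-β * (1 - (χ g).re))

/-- `Φ(P)`, the activity of a plaquette set `P`. -/
def Phi (a : V4) (N : ℕ) (β : ℝ) (χ : G → ℂ) (P : Finset Plaq) : ℝ :=
  ∑ q ∈ Finset.univ.filter (fun q : Form2 a N G => Closed2 a N q ∧ supp2 a N q = P),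
    ∏ p ∈ P, phi β χ (extP a N q p)

/-- Gibbs weight of an edge configuration. -/
def wt (a : V4) (N : ℕ) (β : ℝ) (χ : G → ℂ) (σ : Conf a N G) : ℝ :=
  ∏ p ∈ plaqFinset a N, phi β χ (dConf a N σ p)

/-- Partition function of the lattice gauge theory. -/
def Zpart (a : V4) (N : ℕ) (β : ℝ) (χ : G → ℂ) : ℝ :=
  ∑ σ : Conf a N G, wt a N β χ σ

/-- Probability of an event under `μ_{Λ,β}`. -/
def gibbsProb (a : V4) (N : ℕ) (β : ℝ) (χ : G → ℂ) (A : Conf a N G → Prop) : ℝ :=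
  (∑ σ ∈ Finset.univ.filter A, wt a N β χ σ) / Zpart a N β χ

/-- Expectation of a complex observable under `μ_{Λ,β}`. -/
def gibbsExp (a : V4) (N : ℕ) (β : ℝ) (χ : G → ℂ) (f : Conf a N G → ℂ) : ℂ :=
  (∑ σ : Conf a N G, f σ * (wt a N β χ σ : ℂ)) / ((Zpart a N β χ : ℝ) : ℂ)

/-- Conditional expectation of a complex observable given an event, under `μ_{Λ,β}`. -/
def gibbsCondExp (a : V4) (N : ℕ) (β : ℝ) (χ : G → ℂ)
    (f : Conf a N G → ℂ) (A : Conf a N G → Prop) : ℂ :=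
  (∑ σ ∈ Finset.univ.filter A, f σ * (wt a N β χ σ : ℂ)) /
    (∑ σ ∈ Finset.univ.filter A, ((wt a N β χ σ : ℝ) : ℂ))

/-- A directed edge: a positively oriented edge together with an orientation. -/
abbrev DEdge := Edge × Bool

def dirHead (d : DEdge) : V4 := if d.2 then d.1.1 else d.1.1 + unitVec d.1.2

def dirTail (d : DEdge) : V4 := if d.2 then d.1.1 + unitVec d.1.2 else d.1.1

/-- `γ` is a closed loop: nonempty, consecutive directed edges are adjacent head-to-tail,
and the last edge connects back to the first. -/
structure IsClosedLoop (γ : List DEdge) : Prop where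
  ne : γ ≠ []
  chain : γ.Chain' (fun d d' => dirTail d = dirHead d')
  closed : dirTail (γ.getLast ne) = dirHead (γ.head ne)

/-- `γ` is self avoiding: no edge is repeated (in either orientation). -/
def SelfAvoiding (γ : List DEdge) : Prop := (γ.map Prod.fst).Nodup

/-- All edges of `γ` lie in the cube. -/
def loopInCube (a : V4) (N : ℕ) (γ : List DEdge) : Prop := ∀ d ∈ γ, edgeInCube a N d.1

/-- `Σ_{e} γ_e σ_e`, the holonomy sum of `σ` along the loop `γ`. -/
def loopHol (a : V4) (N : ℕ) (σ : Conf a N G) (γ : List DEdge) : G :=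
  (γ.map (fun d => if d.2 then extE a N σ d.1 else - extE a N σ d.1)).sum

/-- The Wilson loop variable `W_γ(σ) = χ(Σ_e γ_e σ_e)`. -/
def Wloop (a : V4) (N : ℕ) (χ : G → ℂ) (σ : Conf a N G) (γ : List DEdge) : ℂ :=
  χ (loopHol a N σ γ)

/-- `⟨W_γ⟩_{Λ,β}`, the Wilson loop expectation. -/
def wilsonExp (a : V4) (N : ℕ) (β : ℝ) (χ : G → ℂ) (γ : List DEdge) : ℂ :=
  gibbsExp a N β χ (fun σ => Wloop a N χ σ γ)

/-- `Δ_G = min_{g ≠ 0} Re(1 - χ(g))`. -/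
def DeltaG (χ : G → ℂ) : ℝ := sInf {x : ℝ | ∃ g : G, g ≠ 0 ∧ x = 1 - (χ g).re}

/-- `r_β = Σ_{g ≠ 0} φ_β(g)⁶`. -/
def rBeta (β : ℝ) (χ : G → ℂ) : ℝ :=
  ∑ g ∈ Finset.univ.filter (fun g : G => g ≠ 0), (phi β χ g) ^ 6

/-- `A_β = r_β⁻¹ Σ_{g ≠ 0} χ(g) φ_β(g)⁶` (a real number since the sum is real). -/
def ABeta (β : ℝ) (χ : G → ℂ) : ℝ :=
  (rBeta β χ)⁻¹ * ∑ g ∈ Finset.univ.filter (fun g : G => g ≠ 0), (χ g).re * (phi β χ g) ^ 6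

/-- `A_β` as a complex number. -/
def ABetaC (β : ℝ) (χ : G → ℂ) : ℂ :=
  ((rBeta β χ : ℝ) : ℂ)⁻¹ *
    ∑ g ∈ Finset.univ.filter (fun g : G => g ≠ 0), χ g * ((phi β χ g : ℝ) : ℂ) ^ 6

/-- The plaquette `p` is one of the six boundary plaquettes of the 3-cell `c`. -/
def plaqInCell3 (p : Plaq) (c : Cell3) : Prop :=
  p = (c.1, c.2.2.1, c.2.2.2) ∨ p = (c.1, c.2.1, c.2.2.2) ∨ p = (c.1, c.2.1, c.2.2.1) ∨
  p = (c.1 + unitVec c.2.1, c.2.2.1, c.2.2.2) ∨ p = (c.1 + unitVec c.2.2.1, c.2.1, c.2.2.2) ∨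
  p = (c.1 + unitVec c.2.2.2, c.2.1, c.2.2.1)

/-- Two plaquettes share a 3-cell of the cube. -/
def sameCell (a : V4) (N : ℕ) (p₁ p₂ : Plaq) : Prop :=
  ∃ c : Cell3, cell3InCube a N c ∧ plaqInCell3 p₁ c ∧ plaqInCell3 p₂ c

/-- Two plaquette sets are compatible: no 3-cell of the cube contains a plaquette of each. -/
def Compatible (a : V4) (N : ℕ) (P₁ P₂ : Finset Plaq) : Prop :=
  ∀ p₁ ∈ P₁, ∀ p₂ ∈ P₂, ¬ sameCell a N p₁ p₂

/-- The graph `G(P)` on the plaquette set `P` (edges given by sharing a 3-cell) is connected. -/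
def ConnectedPlaqSet (a : V4) (N : ℕ) (P : Finset Plaq) : Prop :=
  ∀ p ∈ P, ∀ q ∈ P, Relation.ReflTransGen (fun u v => u ∈ P ∧ v ∈ P ∧ sameCell a N u v) p q

/-- A vortex: a subset of `Λ₂` whose graph is connected. -/
def IsVortex (a : V4) (N : ℕ) (V : Finset Plaq) : Prop :=
  V ⊆ plaqFinset a N ∧ ConnectedPlaqSet a N V

/-- `P(Σ) = supp(dΣ)`. -/
def PSig (a : V4) (N : ℕ) (σ : Conf a N G) : Finset Plaq :=
  (plaqFinset a N).filter (fun p => dConf a N σ p ≠ 0)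

/-- `V` is one of the vortices in the vortex decomposition of `P`: it is a nonempty connected
subset of `P` with no graph edges to the rest of `P`. -/
def IsVortexOf (a : V4) (N : ℕ) (V P : Finset Plaq) : Prop :=
  V.Nonempty ∧ V ⊆ P ∧ ConnectedPlaqSet a N V ∧ Compatible a N V (P \ V)

/-- The canonically oriented plaquette with base `x` and directions `{i, j}`. -/
def canonPlaq (x : V4) (i j : Fin 4) : Plaq := if i < j then (x, i, j) else (x, j, i)

/-- The minimal vortex `P(e)`: the six positively oriented plaquettes containing the edge `e`. -/
def minVortex (e : Edge) : Finset Plaq :=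
  Finset.image (fun j => canonPlaq e.1 e.2 j) (Finset.univ.filter (fun j => j ≠ e.2)) ∪
  Finset.image (fun j => canonPlaq (e.1 - unitVec j) e.2 j) (Finset.univ.filter (fun j => j ≠ e.2))

/-- `N_γ`: the number of edges `e` of `γ` such that `P(e)` is a vortex of `P(Σ)`. -/
def Ngamma (a : V4) (N : ℕ) (σ : Conf a N G) (γ : List DEdge) : ℕ :=
  ((γ.map Prod.fst).toFinset.filter
    (fun e => IsVortexOf a N (minVortex e) (PSig a N σ))).card

/-- The vertex `x` is on the boundary of the cube. -/
def onBoundary (a : V4) (N : ℕ) (x : V4) : Prop :=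
  inCube a N x ∧ ∃ i, x i = a i ∨ x i = a i + N

/-- Every vertex of the plaquette `p` is a boundary vertex of the cube. -/
def plaqOnBoundary (a : V4) (N : ℕ) (p : Plaq) : Prop :=
  ∀ x ∈ plaqVerts p, onBoundary a N x

/-- The cube with corner `b` and side `M` is contained in the cube with corner `a`, side `N`. -/
def cubeSubset (b : V4) (M : ℕ) (a : V4) (N : ℕ) : Prop :=
  ∀ x, inCube b M x → inCube a N x

/-- The `ℓ^∞` distance between two vertices. -/
def distInf (x y : V4) : ℤ :=
  Finset.univ.sup' Finset.univ_nonempty (fun i => |x i - y i|)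

end

noncomputable section

theorem cell3InCube_of_le {a : V4} {N : ℕ} {x : V4} {i j k : Fin 4} (hij : i < j) (hjk : j < k)
    (hx : inCube a N x) (hi : x i + 1 ≤ a i + N) (hj : x j + 1 ≤ a j + N)
    (hk : x k + 1 ≤ a k + N) : cell3InCube a N (x, i, j, k) := by
  refine ⟨⟨hij, hjk⟩, ?_⟩
  intro y hy m
  have hm := hx m
  simp only [cell3Verts, List.mem_cons, List.not_mem_nil, or_false] at hy
  rcases hy with rfl | rfl | rfl | rfl | rfl | rfl | rfl | rfl <;>
    (try simp only [Pi.add_apply, unitVec]) <;>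
    (try split_ifs) <;> subst_vars <;> omega

theorem bounds_of_mem_plaqFinset {a : V4} {N : ℕ} {x : V4} {i j : Fin 4}
    (hp : (x, i, j) ∈ plaqFinset a N) :
    i < j ∧ inCube a N x ∧ x i + 1 ≤ a i + N ∧ x j + 1 ≤ a j + N := by
  obtain ⟨hij, hv⟩ := (Finset.mem_filter.mp hp).2
  have hi := (hv (x + unitVec i) (by simp [plaqVerts]) i).2
  have hj := (hv (x + unitVec j) (by simp [plaqVerts]) j).2
  exact ⟨hij, hv x (by simp [plaqVerts]), by simpa [unitVec] using hi,
    by simpa [unitVec] using hj⟩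

/-- Translating `x` by at most one unit backwards in a direction `k` makes room for a unit step
in that direction inside the cube, provided the cube has positive side length. -/
theorem exists_base_with_room {a : V4} {N : ℕ} {x : V4} (hN : 1 ≤ N) (hx : inCube a N x)
    (k : Fin 4) :
    ∃ y : V4, (y = x ∨ y + unitVec k = x) ∧ inCube a N y ∧ y k + 1 ≤ a k + N ∧
      ∀ m, m ≠ k → y m = x m := by
  have hxk := hx k
  by_cases h : x k + 1 ≤ a k + N
  · exact ⟨x, Or.inl rfl, hx, h, fun _ _ => rfl⟩
  · refine ⟨x - unitVec k, Or.inr (sub_add_cancel _ _), fun m => ?_, ?_, fun m hm => ?_⟩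
    · have hm := hx m
      simp only [Pi.sub_apply, unitVec]
      split_ifs with hmk
      · subst hmk
        omega
      · omega
    · simp only [Pi.sub_apply, unitVec, if_true]
      omega
    · simp [unitVec, hm]

theorem sameCell_self {a : V4} {N : ℕ} {p : Plaq} (hp : p ∈ plaqFinset a N) :
    sameCell a N p p := by
  obtain ⟨x, i, j⟩ := p
  obtain ⟨hij, hx, hi, hj⟩ := bounds_of_mem_plaqFinset hp
  have hN : 1 ≤ N := by
    have := hx i
    omega
  obtain ⟨k, hki, hkj⟩ : ∃ k : Fin 4, k ≠ i ∧ k ≠ j := by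
    clear * -
    revert i j
    decide
  obtain ⟨y, hyx, hy, hyk, hym⟩ := exists_base_with_room hN hx k
  rw [← hym i hki.symm] at hi
  rw [← hym j hkj.symm] at hj
  suffices h : ∃ c, cell3InCube a N c ∧ plaqInCell3 (x, i, j) c by
    obtain ⟨c, hc, hpc⟩ := h
    exact ⟨c, hc, hpc, hpc⟩
  rcases lt_or_gt_of_ne hki with h₁ | h₁
  · refine ⟨(y, k, i, j), cell3InCube_of_le h₁ hij hy hyk hi hj, ?_⟩
    rcases hyx with rfl | rfl <;> simp [plaqInCell3]
  rcases lt_or_gt_of_ne hkj with h₂ | h₂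
  · refine ⟨(y, i, k, j), cell3InCube_of_le h₁ h₂ hy hi hyk hj, ?_⟩
    rcases hyx with rfl | rfl <;> simp [plaqInCell3]
  · refine ⟨(y, i, j, k), cell3InCube_of_le hij h₂ hy hi hj hyk, ?_⟩
    rcases hyx with rfl | rfl <;> simp [plaqInCell3]

theorem Compatible.symm {a : V4} {N : ℕ} {P₁ P₂ : Finset Plaq} (h : Compatible a N P₁ P₂) :
    Compatible a N P₂ P₁ :=
  fun p₂ h₂ p₁ h₁ ⟨c, hc, hc₂, hc₁⟩ => h p₁ h₁ p₂ h₂ ⟨c, hc, hc₁, hc₂⟩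

theorem Compatible.disjoint {a : V4} {N : ℕ} {P₁ P₂ : Finset Plaq}
    (h : Compatible a N P₁ P₂) (hP₁ : P₁ ⊆ plaqFinset a N) : Disjoint P₁ P₂ :=
  Finset.disjoint_left.mpr fun p h₁ h₂ => h p h₁ p h₂ (sameCell_self (hP₁ h₁))

/-- The restriction of a 2-form to a plaquette set, extended by zero. -/
def restrict2 {G : Type} [AddCommGroup G] {a : V4} {N : ℕ} (q : Form2 a N G)
    (P : Finset Plaq) : Form2 a N G :=
  fun p => if p.1 ∈ P then q p else 0

section

variable {G : Type} [AddCommGroup G] {a : V4} {N : ℕ}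

theorem extP_coe (q : Form2 a N G) (p : {p // p ∈ plaqFinset a N}) : extP a N q p.1 = q p := by
  simp [extP]

theorem extP_restrict2 (q : Form2 a N G) (P : Finset Plaq) (p : Plaq) :
    extP a N (restrict2 q P) p = if p ∈ P then extP a N q p else 0 := by
  simp only [extP, restrict2]
  split_ifs <;> rfl

theorem dForm2_congr {q q' : Form2 a N G} {c : Cell3}
    (h : ∀ p, plaqInCell3 p c → extP a N q p = extP a N q' p) :
    dForm2 a N q c = dForm2 a N q' c := by
  unfold dForm2
  rw [h _ (by simp [plaqInCell3]), h _ (by simp [plaqInCell3]), h _ (by simp [plaqInCell3]),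
    h _ (by simp [plaqInCell3]), h _ (by simp [plaqInCell3]), h _ (by simp [plaqInCell3])]

variable [DecidableEq G]

theorem mem_supp2 {q : Form2 a N G} {p : Plaq} : p ∈ supp2 a N q ↔ extP a N q p ≠ 0 := by
  simp only [supp2, Finset.mem_filter, and_iff_right_iff_imp]
  intro h
  by_contra hp
  exact h (by simp [extP, hp])

theorem eq_zero_of_not_mem_supp2 {q : Form2 a N G} {p : {p // p ∈ plaqFinset a N}}
    (h : p.1 ∉ supp2 a N q) : q p = 0 := by
  rwa [mem_supp2, extP_coe, not_not] at h

theorem supp2_restrict2 {q : Form2 a N G} {P : Finset Plaq} (hP : P ⊆ supp2 a N q) :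
    supp2 a N (restrict2 q P) = P := by
  ext p
  rw [mem_supp2, extP_restrict2]
  by_cases hp : p ∈ P
  · simpa [hp] using mem_supp2.mp (hP hp)
  · simp [hp]

theorem Closed2.restrict2 {q : Form2 a N G} {P₁ P₂ : Finset Plaq} (hq : Closed2 a N q)
    (hcompat : Compatible a N P₁ P₂) (hsupp : supp2 a N q ⊆ P₁ ∪ P₂) :
    Closed2 a N (restrict2 q P₁) := by
  intro c hc
  by_cases h : ∃ p ∈ P₁, plaqInCell3 p c
  · obtain ⟨p₁, hp₁, hpc₁⟩ := h
    rw [← hq c hc]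
    refine dForm2_congr fun p hpc => ?_
    rw [extP_restrict2]
    split_ifs with hp
    · rfl
    · by_contra hne
      rcases Finset.mem_union.mp (hsupp (mem_supp2.mpr (Ne.symm hne))) with h₁ | h₂
      · exact hp h₁
      · exact hcompat p₁ hp₁ p h₂ ⟨c, hc, hpc₁, hpc⟩
  · push Not at h
    have hzero : dForm2 a N (0 : Form2 a N G) c = 0 := by simp [dForm2, extP]
    rw [← hzero]
    refine dForm2_congr fun p hpc => ?_
    rw [extP_restrict2, if_neg fun hp => h p hp hpc]
    simp [extP]

theorem restrict2_add_restrict2 {q : Form2 a N G} {P₁ P₂ : Finset Plaq}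
    (hdisj : Disjoint P₁ P₂) (hsupp : supp2 a N q ⊆ P₁ ∪ P₂) :
    q = restrict2 q P₁ + restrict2 q P₂ := by
  ext p
  simp only [Pi.add_apply, restrict2]
  by_cases h₁ : p.1 ∈ P₁
  · simp [h₁, Finset.disjoint_left.mp hdisj h₁]
  by_cases h₂ : p.1 ∈ P₂
  · simp [h₁, h₂]
  · have h : p.1 ∉ supp2 a N q := fun h => (Finset.mem_union.mp (hsupp h)).elim h₁ h₂
    simp [h₁, h₂, eq_zero_of_not_mem_supp2 h]

theorem restrict2_add_left {q₁ q₂ : Form2 a N G}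
    (hdisj : Disjoint (supp2 a N q₁) (supp2 a N q₂)) :
    restrict2 (q₁ + q₂) (supp2 a N q₁) = q₁ := by
  ext p
  simp only [restrict2, Pi.add_apply]
  split_ifs with h
  · rw [eq_zero_of_not_mem_supp2 (Finset.disjoint_left.mp hdisj h), add_zero]
  · exact (eq_zero_of_not_mem_supp2 h).symm

end

/-- Lemma 3.3: a closed 2-form supported on the union of two compatible plaquette sets
decomposes uniquely into closed 2-forms supported on the pieces. -/
theorem closed_form_unique_decomposition
    (G : Type) [AddCommGroup G] [Fintype G] [DecidableEq G]
    (a : V4) (N : ℕ)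
    (P₁ P₂ : Finset Plaq) (hP₁ : P₁ ⊆ plaqFinset a N) (hP₂ : P₂ ⊆ plaqFinset a N)
    (hcompat : Compatible a N P₁ P₂)
    (q : Form2 a N G) (hq : Closed2 a N q) (hsupp : supp2 a N q = P₁ ∪ P₂) :
    ∃! qq : Form2 a N G × Form2 a N G,
      Closed2 a N qq.1 ∧ Closed2 a N qq.2 ∧
        supp2 a N qq.1 = P₁ ∧ supp2 a N qq.2 = P₂ ∧ q = qq.1 + qq.2 := by
  have hdisj := hcompat.disjoint hP₁
  refine ⟨(restrict2 q P₁, restrict2 q P₂), ⟨?_, ?_, ?_, ?_, ?_⟩, ?_⟩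
  · exact hq.restrict2 hcompat hsupp.subset
  · exact hq.restrict2 hcompat.symm (by rw [hsupp, Finset.union_comm])
  · exact supp2_restrict2 (hsupp ▸ Finset.subset_union_left)
  · exact supp2_restrict2 (hsupp ▸ Finset.subset_union_right)
  · exact restrict2_add_restrict2 hdisj hsupp.subset
  · rintro ⟨q₁, q₂⟩ ⟨-, -, rfl, rfl, rfl⟩
    refine Prod.ext (restrict2_add_left hdisj).symm ?_
    rw [add_comm]
    exact (restrict2_add_left hdisj.symm).symm

end
end

section
/- Let G be a finite group of order at least 3. Then there exists a faithful unitary representation ρ of G such that ‖A‖_op < 1, where A is the average of ρ(g) over g ∈ G₀ and G₀ is the set of non-identity elements attaining min_{h≠1} Re(χ(1) − χ(h)). -/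
open scoped BigOperators

noncomputable section

/-- The operator (`ℓ² → ℓ²`) norm of a complex square matrix. -/
def opNorm {d : ℕ} (A : Matrix (Fin d) (Fin d) ℂ) : ℝ :=
  ‖Matrix.toEuclideanCLM (𝕜 := ℂ) A‖

/-- The character of a unitary representation. -/
def charOf {G : Type} [Group G] {d : ℕ}
    (ρ : G →* Matrix.unitaryGroup (Fin d) ℂ) (g : G) : ℂ :=
  Matrix.trace ((ρ g : Matrix (Fin d) (Fin d) ℂ))

/-- `Δ_G = min_{g ≠ 1} Re(χ(1) - χ(g))`. -/
def DeltaOf {G : Type} [Group G] {d : ℕ}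
    (ρ : G →* Matrix.unitaryGroup (Fin d) ℂ) : ℝ :=
  sInf {x : ℝ | ∃ g : G, g ≠ 1 ∧ x = (charOf ρ 1 - charOf ρ g).re}

/-- `G₀`: the set of non-identity elements attaining the minimum `Δ_G`. -/
def Gzero {G : Type} [Group G] [Fintype G] {d : ℕ}
    [DecidableEq G]
    (ρ : G →* Matrix.unitaryGroup (Fin d) ℂ) : Finset G :=
  Finset.univ.filter (fun g => g ≠ 1 ∧ (charOf ρ 1 - charOf ρ g).re = DeltaOf ρ)

/-- `A = |G₀|⁻¹ Σ_{g ∈ G₀} ρ(g)`. -/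
def Amat {G : Type} [Group G] [Fintype G] [DecidableEq G] {d : ℕ}
    (ρ : G →* Matrix.unitaryGroup (Fin d) ℂ) : Matrix (Fin d) (Fin d) ℂ :=
  (((Gzero ρ).card : ℝ))⁻¹ • ∑ g ∈ Gzero ρ, (ρ g : Matrix (Fin d) (Fin d) ℂ)

open scoped Matrix

/-- The matrix of left translation by `g` on `ℂ^G`. -/
def leftMulMatrix {G : Type} [Group G] [DecidableEq G] (g : G) : Matrix G G ℂ :=
  Matrix.of fun h k => if h = g * k then 1 else 0

/-- The all-ones matrix. -/
def allOnes (G : Type) : Matrix G G ℂ := Matrix.of fun _ _ => 1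

theorem trace_allOnes (G : Type) [Fintype G] : (allOnes G).trace = Fintype.card G := by
  simp [allOnes, Matrix.trace]

section leftMulMatrix

variable {G : Type} [Group G] [DecidableEq G]

theorem leftMulMatrix_one : leftMulMatrix (1 : G) = 1 := by
  ext h k
  simp [leftMulMatrix, Matrix.one_apply]

theorem leftMulMatrix_mul [Fintype G] (g h : G) :
    leftMulMatrix (g * h) = leftMulMatrix g * leftMulMatrix h := by
  ext a b
  simp [leftMulMatrix, Matrix.mul_apply, mul_assoc]

theorem conjTranspose_leftMulMatrix (g : G) :
    (leftMulMatrix g)ᴴ = leftMulMatrix g⁻¹ := by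
  ext a b
  simp only [leftMulMatrix, Matrix.conjTranspose_apply, Matrix.of_apply, apply_ite star, star_one,
    star_zero, eq_inv_mul_iff_mul_eq, eq_comm]

theorem leftMulMatrix_mul_allOnes [Fintype G] (g : G) : leftMulMatrix g * allOnes G = allOnes G := by
  ext a b
  simp [leftMulMatrix, allOnes, Matrix.mul_apply, ← inv_mul_eq_iff_eq_mul]

theorem sum_leftMulMatrix [Fintype G] : ∑ g : G, leftMulMatrix g = allOnes G := by
  ext a b
  simp [leftMulMatrix, allOnes, Matrix.sum_apply, ← mul_inv_eq_iff_eq_mul]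

theorem trace_leftMulMatrix [Fintype G] {g : G} (hg : g ≠ 1) : (leftMulMatrix g).trace = 0 := by
  simp [leftMulMatrix, Matrix.trace, hg]

end leftMulMatrix

/-- An isometry from the orthogonal complement of the constants in `ℂ^G` to `ℂ^m`. -/
theorem exists_coisometry_ker_constants (G : Type) [Fintype G] [DecidableEq G] {m : ℕ}
    (hm : Fintype.card G = m + 1) :
    ∃ U : Matrix (Fin m) G ℂ, U * Uᴴ = 1 ∧
      Uᴴ * U = 1 - (Fintype.card G : ℂ)⁻¹ • allOnes G := by
  have hn : (0 : ℝ) < Fintype.card G := by rw [hm]; positivity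
  let c : EuclideanSpace ℂ G :=
    WithLp.toLp 2 fun _ => ((Real.sqrt (Fintype.card G) : ℝ) : ℂ)⁻¹
  have hc : ‖c‖ = 1 := by
    rw [EuclideanSpace.norm_eq]
    simp [c, hn.ne']
  obtain ⟨b, hb⟩ := Orthonormal.exists_orthonormalBasis_extension_of_card_eq
    (𝕜 := ℂ) (E := EuclideanSpace ℂ G) (ι := Option (Fin m)) (by simp [hm])
    (v := fun _ => c) (s := {none})
    ⟨fun _ => hc, fun i j hij => (hij (Subsingleton.elim i j)).elim⟩
  have hb0 : b none = c := hb none rfl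
  let V : Matrix (Option (Fin m)) G ℂ := Matrix.of fun i g => star (b i g)
  have hV : V * Vᴴ = 1 := by
    ext i j
    have := orthonormal_iff_ite.mp b.orthonormal i j
    simp only [PiLp.inner_apply, RCLike.inner_apply] at this
    simp only [Matrix.mul_apply, Matrix.conjTranspose_apply, Matrix.one_apply, V, Matrix.of_apply,
      star_star]
    rw [← this]
    exact Finset.sum_congr rfl fun _ _ => mul_comm _ _
  have hV' : Vᴴ * V = 1 :=
    (Matrix.mul_eq_one_comm_of_card_eq _ _ _ (by simp [hm])).mp hV
  refine ⟨Matrix.of fun i g => V (some i) g, ?_, ?_⟩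
  · ext i j
    have := congr_fun (congr_fun hV (some i)) (some j)
    simpa [Matrix.mul_apply, Matrix.one_apply] using this
  · ext g h
    have := congr_fun (congr_fun hV' g) h
    rw [Matrix.mul_apply, Fintype.sum_option] at this
    rw [Matrix.sub_apply, ← this]
    have hs : ((Real.sqrt (Fintype.card G) : ℝ) : ℂ)⁻¹ * ((Real.sqrt (Fintype.card G) : ℝ) : ℂ)⁻¹
        = (Fintype.card G : ℂ)⁻¹ := by
      rw [← mul_inv, ← Complex.ofReal_mul, Real.mul_self_sqrt hn.le, Complex.ofReal_natCast]
    simp [Matrix.mul_apply, V, hb0, c, allOnes, hs]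

theorem charOf_one {G : Type} [Group G] {d : ℕ}
    (ρ : G →* Matrix.unitaryGroup (Fin d) ℂ) : charOf ρ 1 = d := by
  simp [charOf]

section compression

variable {G : Type} [Group G] [Fintype G] [DecidableEq G] {m : ℕ} {U : Matrix (Fin m) G ℂ}

theorem mul_allOnes_eq_zero (h1 : U * Uᴴ = 1)
    (h2 : Uᴴ * U = 1 - (Fintype.card G : ℂ)⁻¹ • allOnes G) : U * allOnes G = 0 := by
  have h : U * (Uᴴ * U) = U := by rw [← Matrix.mul_assoc, h1, Matrix.one_mul]
  rw [h2, Matrix.mul_sub, Matrix.mul_one, sub_eq_self, Matrix.mul_smul] at h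
  exact (smul_eq_zero.mp h).resolve_left (by simp)

theorem compression_mul (h1 : U * Uᴴ = 1)
    (h2 : Uᴴ * U = 1 - (Fintype.card G : ℂ)⁻¹ • allOnes G) (g h : G) :
    U * leftMulMatrix (g * h) * Uᴴ = U * leftMulMatrix g * Uᴴ * (U * leftMulMatrix h * Uᴴ) := by
  have key : U * leftMulMatrix g * (Uᴴ * U) = U * leftMulMatrix g := by
    rw [h2, Matrix.mul_sub, Matrix.mul_one, Matrix.mul_smul, Matrix.mul_assoc U,
      leftMulMatrix_mul_allOnes, mul_allOnes_eq_zero h1 h2, smul_zero, sub_zero]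
  calc U * leftMulMatrix (g * h) * Uᴴ
      = U * leftMulMatrix g * leftMulMatrix h * Uᴴ := by
        rw [leftMulMatrix_mul, Matrix.mul_assoc U (leftMulMatrix g)]
    _ = U * leftMulMatrix g * (Uᴴ * U) * leftMulMatrix h * Uᴴ := by rw [key]
    _ = _ := by simp only [Matrix.mul_assoc]

/-- The regular representation compressed to the orthogonal complement of the constants. -/
def compressedRegular (U : Matrix (Fin m) G ℂ) (h1 : U * Uᴴ = 1)
    (h2 : Uᴴ * U = 1 - (Fintype.card G : ℂ)⁻¹ • allOnes G) :
    G →* Matrix.unitaryGroup (Fin m) ℂ where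
  toFun g := ⟨U * leftMulMatrix g * Uᴴ, by
    rw [Matrix.mem_unitaryGroup_iff, Matrix.star_eq_conjTranspose]
    have : (U * leftMulMatrix g * Uᴴ)ᴴ = U * leftMulMatrix g⁻¹ * Uᴴ := by
      simp only [Matrix.conjTranspose_mul, Matrix.conjTranspose_conjTranspose,
        conjTranspose_leftMulMatrix, Matrix.mul_assoc]
    rw [this, ← compression_mul h1 h2, mul_inv_cancel, leftMulMatrix_one, Matrix.mul_one, h1]⟩
  map_one' := Subtype.ext (by simp [leftMulMatrix_one, h1])
  map_mul' g h := Subtype.ext (compression_mul h1 h2 g h)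

variable (h1 : U * Uᴴ = 1) (h2 : Uᴴ * U = 1 - (Fintype.card G : ℂ)⁻¹ • allOnes G)

theorem charOf_compressedRegular {g : G} (hg : g ≠ 1) :
    charOf (compressedRegular U h1 h2) g = -1 := by
  change (U * leftMulMatrix g * Uᴴ).trace = -1
  rw [Matrix.trace_mul_comm, ← Matrix.mul_assoc, Matrix.trace_mul_comm, h2, Matrix.mul_sub,
    Matrix.mul_one, Matrix.mul_smul, leftMulMatrix_mul_allOnes, Matrix.trace_sub,
    trace_leftMulMatrix hg, Matrix.trace_smul, trace_allOnes]
  simp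

theorem compressedRegular_injective : Function.Injective (compressedRegular U h1 h2) := by
  refine (injective_iff_map_eq_one _).mpr fun g hg => ?_
  by_contra hne
  have h : charOf (compressedRegular U h1 h2) g = charOf (compressedRegular U h1 h2) 1 := by
    rw [charOf, charOf, hg, map_one]
  rw [charOf_compressedRegular h1 h2 hne, charOf_one] at h
  have h' := congr_arg Complex.re h
  simp only [Complex.neg_re, Complex.one_re, Complex.natCast_re] at h'
  linarith [(Nat.cast_nonneg m : (0 : ℝ) ≤ m)]

theorem Gzero_compressedRegular [Nontrivial G] :
    Gzero (compressedRegular U h1 h2) = Finset.univ.erase 1 := by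
  have hval : ∀ g : G, g ≠ 1 → (charOf (compressedRegular U h1 h2) 1 -
      charOf (compressedRegular U h1 h2) g).re = m + 1 := fun g hg => by
    simp [charOf_compressedRegular h1 h2 hg, charOf_one]
  have hΔ : DeltaOf (compressedRegular U h1 h2) = m + 1 := by
    obtain ⟨g, hg⟩ := exists_ne (1 : G)
    rw [DeltaOf, ← csInf_singleton ((m : ℝ) + 1)]
    congr 1
    ext x
    exact ⟨fun ⟨k, hk, hx⟩ => hx.trans (hval k hk), fun hx => ⟨g, hg, hx.trans (hval g hg).symm⟩⟩
  ext g
  simp only [Gzero, Finset.mem_filter, Finset.mem_univ, true_and, Finset.mem_erase, and_true, hΔ]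
  exact ⟨And.left, fun hg => ⟨hg, hval g hg⟩⟩

theorem sum_compressedRegular :
    ∑ g : G, (compressedRegular U h1 h2 g : Matrix (Fin m) (Fin m) ℂ) = 0 := by
  change ∑ g : G, U * leftMulMatrix g * Uᴴ = 0
  rw [← Matrix.sum_mul, ← Matrix.mul_sum, sum_leftMulMatrix, mul_allOnes_eq_zero h1 h2,
    Matrix.zero_mul]

theorem Amat_compressedRegular [Nontrivial G] :
    Amat (compressedRegular U h1 h2) = (-((Fintype.card G - 1 : ℕ) : ℂ)⁻¹) • 1 := by
  have hsum := Finset.add_sum_erase Finset.univ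
    (fun g => (compressedRegular U h1 h2 g : Matrix (Fin m) (Fin m) ℂ)) (Finset.mem_univ 1)
  rw [sum_compressedRegular, map_one] at hsum
  rw [Amat, Gzero_compressedRegular, eq_neg_of_add_eq_zero_right hsum,
    Finset.card_erase_of_mem (Finset.mem_univ _), Finset.card_univ]
  ext i j
  simp [Matrix.smul_apply]

end compression

theorem opNorm_smul_one_le {d : ℕ} (c : ℂ) :
    opNorm (c • (1 : Matrix (Fin d) (Fin d) ℂ)) ≤ ‖c‖ := by
  rw [opNorm, map_smul, map_one, norm_smul]
  exact mul_le_of_le_one_right (norm_nonneg c) ContinuousLinearMap.norm_id_le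

/-- Lemma A.1: every finite group of order at least 3 admits a faithful unitary
representation with `‖A‖_op < 1`. -/
theorem exists_faithful_rep_opNorm_lt_one
    (G : Type) [Group G] [Fintype G] [DecidableEq G]
    (h3 : 3 ≤ Fintype.card G) :
    ∃ (d : ℕ) (ρ : G →* Matrix.unitaryGroup (Fin d) ℂ),
      Function.Injective ρ ∧ opNorm (Amat ρ) < 1 := by
  have : Nontrivial G := Fintype.one_lt_card_iff_nontrivial.mp (by omega)
  obtain ⟨U, h1, h2⟩ := exists_coisometry_ker_constants G (m := Fintype.card G - 1) (by omega)
  refine ⟨_, compressedRegular U h1 h2, compressedRegular_injective h1 h2, ?_⟩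
  rw [Amat_compressedRegular]
  refine (opNorm_smul_one_le _).trans_lt ?_
  rw [norm_neg, norm_inv, Complex.norm_natCast]
  exact inv_lt_one_of_one_lt₀ (by exact_mod_cast (by omega : 1 < Fintype.card G - 1))

end
end

section
/- Let G be a finite group of order at least 3 and let ρ be a faithful irreducible unitary representation of G. Then ‖A‖_op < 1, where A is the average of ρ(g) over g ∈ G₀ and G₀ is the set of non-identity elements attaining min_{h≠1} Re(χ(1) − χ(h)). -/
open scoped BigOperators

noncomputable section

/-- A linear contraction of a finite-dimensional space with no nonzero vector of preserved (or
increased) norm has operator norm less than one. -/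
theorem ContinuousLinearMap.norm_lt_one_of_forall_norm_lt {E : Type*} [NormedAddCommGroup E]
    [NormedSpace ℂ E] [FiniteDimensional ℂ E] (T : E →L[ℂ] E)
    (h : ∀ v, v ≠ 0 → ‖T v‖ < ‖v‖) : ‖T‖ < 1 := by
  have : ProperSpace E := FiniteDimensional.proper ℂ E
  obtain ⟨x, hx, hmax⟩ := (isCompact_closedBall (0 : E) 1).exists_isMaxOn
    ⟨0, by simp⟩ (f := fun v => ‖T v‖) (by fun_prop)
  have hlt : ‖T x‖ < 1 := by
    rcases eq_or_ne x 0 with rfl | hx0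
    · simp
    · exact (h x hx0).trans_le (by simpa using hx)
  refine (T.opNorm_le_of_unit_norm (norm_nonneg _) fun v hv => ?_).trans_lt hlt
  exact hmax (by simp [hv])

/-- Vectors of norm `r` whose average has norm at least `r` are all equal to their average. -/
theorem eq_average_of_norm_le {ι E : Type*} [NormedAddCommGroup E] [InnerProductSpace ℂ E]
    (s : Finset ι) (f : ι → E) (r : ℝ) (hf : ∀ i ∈ s, ‖f i‖ = r) (m : E)
    (hm : ∑ i ∈ s, f i = (s.card : ℂ) • m) (hr : r ≤ ‖m‖) : ∀ i ∈ s, f i = m := by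
  intro j hj
  have hr0 : 0 ≤ r := hf j hj ▸ norm_nonneg _
  have hinner : ∑ i ∈ s, RCLike.re (inner ℂ m (f i)) = s.card * ‖m‖ ^ 2 := by
    rw [← map_sum, ← inner_sum, hm, inner_smul_right, inner_self_eq_norm_sq_to_K]
    norm_cast
    simp [-Complex.ofReal_pow]
  have hsum : ∑ i ∈ s, ‖m - f i‖ ^ 2 ≤ 0 := by
    have : ∑ i ∈ s, ‖m - f i‖ ^ 2 = s.card * (r ^ 2 - ‖m‖ ^ 2) := by
      rw [Finset.sum_congr rfl fun i hi => by rw [norm_sub_sq (𝕜 := ℂ), hf i hi],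
        Finset.sum_add_distrib, Finset.sum_sub_distrib, ← Finset.mul_sum, hinner]
      simp
      ring
    rw [this]
    exact mul_nonpos_of_nonneg_of_nonpos (by positivity) (by nlinarith)
  have hzero := (Finset.sum_eq_zero_iff_of_nonneg fun i _ => sq_nonneg ‖m - f i‖).1
    (hsum.antisymm (Finset.sum_nonneg fun i _ => sq_nonneg _)) j hj
  exact (sub_eq_zero.1 (by simpa using hzero)).symm

section Character

variable {G : Type} [Group G] {d : ℕ} (ρ : G →* Matrix.unitaryGroup (Fin d) ℂ)

theorem charOf_conj (g h : G) : charOf ρ (h⁻¹ * g * h) = charOf ρ g := by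
  unfold charOf
  rw [map_mul, Submonoid.coe_mul, Matrix.trace_mul_comm, ← Submonoid.coe_mul, ← map_mul]
  group

theorem charOf_inv (g : G) : charOf ρ g⁻¹ = star (charOf ρ g) := by
  unfold charOf
  rw [map_inv, Matrix.UnitaryGroup.inv_val, Matrix.star_eq_conjTranspose,
    Matrix.trace_conjTranspose]

theorem charOf_one_s19 : charOf ρ 1 = d := by
  simp [charOf]

theorem neg_natCast_le_re_charOf (g : G) : -(d : ℝ) ≤ (charOf ρ g).re := by
  have h : ‖charOf ρ g‖ ≤ d := by
    unfold charOf Matrix.trace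
    refine (norm_sum_le _ _).trans ((Finset.sum_le_sum fun i _ =>
      entry_norm_bound_of_unitary (ρ g).2 i i).trans ?_)
    simp
  exact neg_le_of_abs_le ((Complex.abs_re_le_norm _).trans h)

theorem coe_map_mul_mulVec (g h : G) (v : Fin d → ℂ) :
    (ρ (g * h) : Matrix (Fin d) (Fin d) ℂ).mulVec v
      = (ρ g : Matrix (Fin d) (Fin d) ℂ).mulVec ((ρ h : Matrix (Fin d) (Fin d) ℂ).mulVec v) := by
  rw [map_mul, Submonoid.coe_mul, Matrix.mulVec_mulVec]

theorem norm_toEuclideanCLM_coe (g : G) (v : EuclideanSpace ℂ (Fin d)) :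
    ‖Matrix.toEuclideanCLM (𝕜 := ℂ) (ρ g : Matrix (Fin d) (Fin d) ℂ) v‖ = ‖v‖ :=
  ContinuousLinearMap.norm_map_of_mem_unitary (Unitary.map_mem _ (ρ g).2) v

variable [Fintype G]

theorem finite_setOf_charOf_sub :
    {x : ℝ | ∃ g : G, g ≠ 1 ∧ x = (charOf ρ 1 - charOf ρ g).re}.Finite :=
  (Set.finite_range fun g => (charOf ρ 1 - charOf ρ g).re).subset <| by
    rintro x ⟨g, -, rfl⟩
    exact ⟨g, rfl⟩

theorem DeltaOf_le {g : G} (hg : g ≠ 1) : DeltaOf ρ ≤ (charOf ρ 1 - charOf ρ g).re :=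
  csInf_le (finite_setOf_charOf_sub ρ).bddBelow ⟨g, hg, rfl⟩

variable [DecidableEq G]

theorem mem_Gzero {g : G} :
    g ∈ Gzero ρ ↔ g ≠ 1 ∧ (charOf ρ 1 - charOf ρ g).re = DeltaOf ρ := by
  simp [Gzero]

theorem Gzero_nonempty [Nontrivial G] : (Gzero ρ).Nonempty := by
  obtain ⟨g, hg⟩ := exists_ne (1 : G)
  obtain ⟨h, h1, h2⟩ := Set.Nonempty.csInf_mem
    (s := {x : ℝ | ∃ g : G, g ≠ 1 ∧ x = (charOf ρ 1 - charOf ρ g).re}) ⟨_, g, hg, rfl⟩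
    (finite_setOf_charOf_sub ρ)
  exact ⟨h, (mem_Gzero ρ).2 ⟨h1, h2.symm⟩⟩

theorem conj_mem_Gzero {g : G} (hg : g ∈ Gzero ρ) (h : G) : h⁻¹ * g * h ∈ Gzero ρ := by
  rw [mem_Gzero] at hg ⊢
  refine ⟨fun h1 => hg.1 ?_, by rw [charOf_conj]; exact hg.2⟩
  rw [show g = h * (h⁻¹ * g * h) * h⁻¹ by group, h1]
  group

theorem inv_mem_Gzero {g : G} (hg : g ∈ Gzero ρ) : g⁻¹ ∈ Gzero ρ := by
  rw [mem_Gzero] at hg ⊢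
  refine ⟨inv_ne_one.2 hg.1, ?_⟩
  rw [← hg.2, charOf_inv]
  simp

/-- If one minimizer acts as `-1`, then every non-identity element is a minimizer. -/
theorem mem_Gzero_of_coe_eq_neg_one {z : G} (hz : z ∈ Gzero ρ)
    (hneg : (ρ z : Matrix (Fin d) (Fin d) ℂ) = -1) {g : G} (hg : g ≠ 1) : g ∈ Gzero ρ := by
  have hz' := ((mem_Gzero ρ).1 hz).2
  have hchar : charOf ρ z = -d := by simp [charOf, hneg]
  refine (mem_Gzero ρ).2 ⟨hg, le_antisymm ?_ (DeltaOf_le ρ hg)⟩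
  rw [← hz', hchar, charOf_one_s19]
  have := neg_natCast_le_re_charOf ρ g
  simp
  linarith

/-- The vectors on which all minimizers act in the same way. -/
def GzeroEqualizer : Submodule ℂ (Fin d → ℂ) where
  carrier := {v | ∀ g ∈ Gzero ρ, ∀ h ∈ Gzero ρ,
    (ρ g : Matrix (Fin d) (Fin d) ℂ).mulVec v = (ρ h : Matrix (Fin d) (Fin d) ℂ).mulVec v}
  add_mem' hv hw g hg h hh := by
    rw [Matrix.mulVec_add, Matrix.mulVec_add, hv g hg h hh, hw g hg h hh]
  zero_mem' g _ h _ := by simp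
  smul_mem' c v hv g hg h hh := by
    rw [Matrix.mulVec_smul, Matrix.mulVec_smul, hv g hg h hh]

theorem mulVec_mem_GzeroEqualizer (k : G) (v : Fin d → ℂ) (hv : v ∈ GzeroEqualizer ρ) :
    (ρ k : Matrix (Fin d) (Fin d) ℂ).mulVec v ∈ GzeroEqualizer ρ := by
  intro g hg h hh
  rw [← coe_map_mul_mulVec, ← coe_map_mul_mulVec, show g * k = k * (k⁻¹ * g * k) by group,
    show h * k = k * (k⁻¹ * h * k) by group, coe_map_mul_mulVec ρ k, coe_map_mul_mulVec ρ k,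
    hv _ (conj_mem_Gzero ρ hg k) _ (conj_mem_Gzero ρ hh k)]

/-- A vector whose norm is not decreased by the average is treated equally by all minimizers. -/
theorem ofLp_mem_GzeroEqualizer [Nontrivial G] (v : EuclideanSpace ℂ (Fin d))
    (hv : ‖v‖ ≤ ‖Matrix.toEuclideanCLM (𝕜 := ℂ) (Amat ρ) v‖) :
    v.ofLp ∈ GzeroEqualizer ρ := by
  have hcard : ((Gzero ρ).card : ℂ) ≠ 0 := by
    exact_mod_cast (Gzero_nonempty ρ).card_pos.ne'
  have hA : ∑ g ∈ Gzero ρ, (ρ g : Matrix (Fin d) (Fin d) ℂ)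
      = ((Gzero ρ).card : ℂ) • Amat ρ := by
    rw [Amat, ← Complex.coe_smul, smul_smul]
    push_cast
    rw [mul_inv_cancel₀ hcard, one_smul]
  have key := eq_average_of_norm_le (Gzero ρ)
    (fun g => Matrix.toEuclideanCLM (𝕜 := ℂ) (ρ g : Matrix (Fin d) (Fin d) ℂ) v) ‖v‖
    (fun g _ => norm_toEuclideanCLM_coe ρ g v) _ (by
      rw [← sum_apply, ← map_sum, hA, map_smul,
        smul_apply]) hv
  intro g hg h hh
  have := congrArg WithLp.ofLp ((key g hg).trans (key h hh).symm)
  simpa using this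

end Character

/-- Lemma A.2: for a finite group of order at least 3, any faithful irreducible unitary
representation satisfies `‖A‖_op < 1`. -/
theorem irreducible_faithful_rep_opNorm_lt_one
    (G : Type) [Group G] [Fintype G] [DecidableEq G]
    (h3 : 3 ≤ Fintype.card G) (d : ℕ)
    (ρ : G →* Matrix.unitaryGroup (Fin d) ℂ)
    (hfaithful : Function.Injective ρ)
    (hirred : ∀ W : Submodule ℂ (Fin d → ℂ),
        (∀ g : G, ∀ v ∈ W, Matrix.mulVec ((ρ g : Matrix (Fin d) (Fin d) ℂ)) v ∈ W) →
        W = ⊥ ∨ W = ⊤) :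
    opNorm (Amat ρ) < 1 := by
  have : Nontrivial G := Fintype.one_lt_card_iff_nontrivial.1 (by omega)
  refine ContinuousLinearMap.norm_lt_one_of_forall_norm_lt _ fun v hv0 => ?_
  by_contra! hv
  have hmem := ofLp_mem_GzeroEqualizer ρ v hv
  have htop : GzeroEqualizer ρ = ⊤ := by
    refine (hirred _ (mulVec_mem_GzeroEqualizer ρ)).resolve_left fun hbot => hv0 ?_
    rw [hbot, Submodule.mem_bot] at hmem
    exact (WithLp.ofLp_eq_zero 2).1 hmem
  have hunique : ∀ g ∈ Gzero ρ, ∀ h ∈ Gzero ρ, g = h := fun g hg h hh =>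
    hfaithful <| Subtype.ext <| Matrix.mulVec_injective <| funext fun w =>
      (htop ▸ Submodule.mem_top : w ∈ GzeroEqualizer ρ) g hg h hh
  obtain ⟨z, hz⟩ := Gzero_nonempty ρ
  have hz1 : z ≠ 1 := ((mem_Gzero ρ).1 hz).1
  have hsq : z * z = 1 := by
    nth_rewrite 1 [hunique z hz _ (inv_mem_Gzero ρ hz)]
    exact inv_mul_cancel z
  have hcomm (g : G) : z * g = g * z := by
    nth_rewrite 2 [hunique z hz _ (conj_mem_Gzero ρ hz g)]
    group
  have hfix : LinearMap.eqLocus (Matrix.mulVecLin (ρ z : Matrix (Fin d) (Fin d) ℂ))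
      LinearMap.id = ⊥ := by
    refine (hirred _ fun g w hw => ?_).resolve_right fun h => hz1 ?_
    · have hw' : (ρ z : Matrix (Fin d) (Fin d) ℂ).mulVec w = w := hw
      change (ρ z : Matrix (Fin d) (Fin d) ℂ).mulVec _ = _
      rw [← coe_map_mul_mulVec, hcomm, coe_map_mul_mulVec, hw']
      rfl
    · refine hfaithful <| Subtype.ext <| Matrix.mulVec_injective <| funext fun w => ?_
      have hw : (ρ z : Matrix (Fin d) (Fin d) ℂ).mulVec w = w :=
        (h ▸ Submodule.mem_top : w ∈ LinearMap.eqLocus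
          (Matrix.mulVecLin (ρ z : Matrix (Fin d) (Fin d) ℂ)) LinearMap.id)
      simpa using hw
  have hneg : (ρ z : Matrix (Fin d) (Fin d) ℂ) = -1 := by
    refine Matrix.mulVec_injective <| funext fun w => ?_
    have hw : (ρ z : Matrix (Fin d) (Fin d) ℂ).mulVec w + w ∈ LinearMap.eqLocus
        (Matrix.mulVecLin (ρ z : Matrix (Fin d) (Fin d) ℂ)) LinearMap.id := by
      change (ρ z : Matrix (Fin d) (Fin d) ℂ).mulVec _ = _
      rw [Matrix.mulVec_add, ← coe_map_mul_mulVec, hsq]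
      simp [add_comm]
    rw [hfix, Submodule.mem_bot] at hw
    rw [eq_neg_of_add_eq_zero_left hw, Matrix.neg_mulVec, Matrix.one_mulVec]
  have hcard : (Finset.univ : Finset G) ⊆ {1, z} := fun g _ => by
    by_cases hg : g = 1
    · simp [hg]
    · simp [hunique g (mem_Gzero_of_coe_eq_neg_one ρ hz hneg hg) z hz]
  have := (Finset.card_le_card hcard).trans Finset.card_le_two
  rw [Finset.card_univ] at this
  omega

end
end
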